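/- arXiv:2103.09175 — 2 statements merged into one kernel-verified Lean document; each statement's English description precedes it below -/
import Mathlib

section
/- First-column recursion of NLRC in the overlapping regime: for every integer m with p+2 ≤ m ≤ 2p+1 and every index 1 ≤ i ≤ m−p−1, NLRC_{p,m}(i,1) = φ_{m−p−i} · φ_{m−p−1} + NLRC_{p,m−1}(i,1), where φ₀ := −1. -/
open Matrix Finset

theorem border_inv (n : ℕ) (A : Matrix (Fin (n+1)) (Fin (n+1)) ℝ) (B : Matrix (Fin n) (Fin n) ℝ)
    (hAB : ∀ i j, B i j = A i.castSucc j.castSucc) (hA : IsUnit A.det) (hB : IsUnit B.det)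
    (hsymm : Aᵀ = A) (s : ℝ) (v : Fin (n+1) → ℝ)
    (hv : A *ᵥ v = s • Pi.single (Fin.last n) 1) (hvl : v (Fin.last n) = 1) (i j : Fin n) :
    s * A⁻¹ i.castSucc j.castSucc = v i.castSucc * v j.castSucc + s * B⁻¹ i j := by
  have hvA : ∀ k, v k = s * A⁻¹ k (Fin.last n) := by
    intro k
    have h : v = A⁻¹ *ᵥ (s • Pi.single (Fin.last n) 1) := by
      rw [← hv, Matrix.mulVec_mulVec, Matrix.nonsing_inv_mul _ hA, Matrix.one_mulVec]
    rw [h, Matrix.mulVec_smul, Matrix.mulVec_single_one]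
    simp
  have hAs : ∀ a b, A⁻¹ a b = A⁻¹ b a := by
    intro a b
    have : (A⁻¹)ᵀ = A⁻¹ := by rw [Matrix.transpose_nonsing_inv, hsymm]
    conv_lhs => rw [← this]
    rfl
  let w : Fin (n+1) → ℝ := fun k => s * A⁻¹ k j.castSucc - v j.castSucc * v k
  have hwl : w (Fin.last n) = 0 := by
    simp only [w]
    rw [hvl, hAs, hvA j.castSucc]; ring
  have hAw : ∀ k : Fin n, (A *ᵥ w) k.castSucc = s * (1 : Matrix (Fin n) (Fin n) ℝ) k j := by
    intro k
    have h1 : w = s • (A⁻¹ *ᵥ Pi.single j.castSucc 1) - v j.castSucc • v := by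
      funext a
      simp [w, Matrix.mulVec_single_one]
    rw [h1, Matrix.mulVec_sub, Matrix.mulVec_smul, Matrix.mulVec_smul, hv, Matrix.mulVec_mulVec,
      Matrix.mul_nonsing_inv _ hA, Matrix.one_mulVec]
    simp [Pi.single_apply, Matrix.one_apply, Fin.castSucc_ne_last]
  have hBw : B *ᵥ (fun k => w k.castSucc) = s • Pi.single j 1 := by
    funext k
    have := hAw k
    rw [Matrix.mulVec, dotProduct, Fin.sum_univ_castSucc, hwl] at this
    simp only [Matrix.mulVec, dotProduct, hAB]
    simp only [mul_zero, add_zero] at this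
    rw [this]
    simp [Pi.single_apply, Matrix.one_apply]
  have h : (fun k : Fin n => w k.castSucc) = s • (B⁻¹ *ᵥ Pi.single j 1) := by
    rw [← Matrix.mulVec_smul, ← hBw, Matrix.mulVec_mulVec, Matrix.nonsing_inv_mul _ hB,
      Matrix.one_mulVec]
  have h2 := congrFun h i
  simp [w, Matrix.mulVec_single_one] at h2
  linarith

/-- Context: AR(p) coefficients `φ`, white-noise variance `σ2`, autocovariance
sequence `γ` satisfying the Yule–Walker equations, and the autocovariance
Toeplitz matrices `Γ m`, assumed positive definite for `m ≥ 1`. -/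
theorem stmt_7
    (p : ℕ) (hp : 1 ≤ p)
    (φ : ℕ → ℝ) (hφ0 : φ 0 = -1)
    (σ2 : ℝ) (hσ : 0 < σ2)
    (γ : ℤ → ℝ)
    (hsym : ∀ j : ℤ, γ (-j) = γ j)
    (hYW0 : γ 0 = (∑ i ∈ Finset.Icc 1 p, φ i * γ (i : ℤ)) + σ2)
    (hYW : ∀ j : ℤ, 1 ≤ j → γ j = ∑ i ∈ Finset.Icc 1 p, φ i * γ (j - (i : ℤ)))
    (Γ : (m : ℕ) → Matrix (Fin m) (Fin m) ℝ)
    (hΓ : ∀ m : ℕ, ∀ i j : Fin m, Γ m i j = γ |(i : ℤ) - (j : ℤ)|)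
    (hpd : ∀ m : ℕ, 1 ≤ m → (Γ m).PosDef)
    (m : ℕ) (hm1 : p + 2 ≤ m) (hm2 : m ≤ 2 * p + 1)
    (i : ℕ) (hi1 : 1 ≤ i) (hi2 : i ≤ m - p - 1) :
    σ2 * (Γ m)⁻¹ ⟨p + i - 1, by omega⟩ ⟨p, by omega⟩
      = φ (m - p - i) * φ (m - p - 1)
        + σ2 * (Γ (m - 1))⁻¹ ⟨p + i - 1, by omega⟩ ⟨p, by omega⟩ := by
  obtain ⟨n, rfl⟩ : ∃ n, m = n + 1 := ⟨m - 1, by omega⟩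
  have habs : ∀ x : ℤ, γ |x| = γ x := by
    intro x
    rcases abs_choice x with h | h <;> rw [h]
    exact hsym x
  let f : ℕ → ℝ := fun k => if n - k ≤ p then -φ (n - k) else 0
  have hmv : Γ (n+1) *ᵥ (fun k => f k) = σ2 • Pi.single (Fin.last n) 1 := by
    funext j
    have hj : (j : ℕ) ≤ n := by omega
    have key : (Γ (n+1) *ᵥ (fun k => f k)) j
        = γ ((n : ℤ) - j) - ∑ l ∈ Finset.Icc 1 p, φ l * γ ((n : ℤ) - j - l) := by
      simp only [Matrix.mulVec, dotProduct, hΓ, habs]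
      rw [Fin.sum_univ_eq_sum_range (fun k => γ ((j : ℤ) - k) * f k) (n+1),
        ← Finset.sum_range_reflect]
      have e : ∀ l ∈ Finset.range (n+1), γ ((j : ℤ) - ((n + 1 - 1 - l : ℕ) : ℤ)) * f (n + 1 - 1 - l)
          = if l ≤ p then -(φ l * γ ((n : ℤ) - j - l)) else 0 := by
        intro l hl
        have hl' : l ≤ n := by simpa [Nat.lt_succ_iff] using hl
        have e1 : n - (n + 1 - 1 - l) = l := by omega
        simp only [f, e1]
        rw [← hsym]
        have e2 : -((j : ℤ) - ((n + 1 - 1 - l : ℕ) : ℤ)) = (n : ℤ) - j - l := by omega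
        rw [e2]
        split_ifs <;> ring
      rw [Finset.sum_congr rfl e, ← Finset.sum_filter]
      have e3 : (Finset.range (n+1)).filter (fun l => l ≤ p) = insert 0 (Finset.Icc 1 p) := by
        ext l
        simp only [Finset.mem_filter, Finset.mem_range, Finset.mem_insert, Finset.mem_Icc]
        omega
      rw [e3, Finset.sum_insert (by simp), hφ0, Finset.sum_neg_distrib]
      simp; ring
    rw [key]
    by_cases h : j = Fin.last n
    · subst h
      simp only [Fin.val_last, sub_self, zero_sub, hsym]
      rw [hYW0]; simp
    · have hlt : (j : ℕ) < n := by
        rcases lt_or_eq_of_le hj with h' | h'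
        · exact h'
        · exact absurd (Fin.ext h') h
      rw [← hYW _ (by omega)]
      simp [h]
  have hT : (Γ (n+1))ᵀ = Γ (n+1) := by
    ext a b
    rw [Matrix.transpose_apply, hΓ, hΓ, abs_sub_comm]
  have hu : ∀ q, 1 ≤ q → IsUnit (Γ q).det := fun q hq => (hpd q hq).det_pos.ne'.isUnit
  have main := border_inv n (Γ (n+1)) (Γ n) (by intro a b; simp [hΓ]) (hu _ (by omega))
    (hu _ (by omega)) hT σ2 (fun k => f k) hmv (by simp [f, hφ0])
    ⟨p + i - 1, by omega⟩ ⟨p, by omega⟩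
  have f1 : f (p + i - 1) = -φ (n + 1 - p - i) := by
    have : n - (p + i - 1) = n + 1 - p - i := by omega
    simp only [f, this]
    rw [if_pos (by omega)]
  have f2 : f p = -φ (n + 1 - p - 1) := by
    have : n - p = n + 1 - p - 1 := by omega
    simp only [f, this]
    rw [if_pos (by omega)]
  simp only [Fin.castSucc_mk, f1, f2, neg_mul_neg] at main
  exact main
end

section
/- Adjugate recursion in the overlapping regime: for every integer m with p+2 ≤ m ≤ 2p+1 and every index 1 ≤ i ≤ m−p−1, adj(Γ_m)(p+i, p+1) = φ_{m−p−1} · φ_{m−p−i} · det(Γ_{m−1}) + σ² · adj(Γ_{m−1})(p+i, p+1), where adj denotes the adjugate (transpose of the cofactor matrix). -/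
open Matrix Finset

/-- Adjugate of a bordered symmetric matrix whose border is `B b`. -/
theorem bordered_adj (n : ℕ) (A : Matrix (Fin (n+1)) (Fin (n+1)) ℝ) (B : Matrix (Fin n) (Fin n) ℝ)
    (b c : Fin n → ℝ) (g s : ℝ)
    (h11 : ∀ i j, A (Fin.castSucc i) (Fin.castSucc j) = B i j)
    (h12 : ∀ i, A (Fin.castSucc i) (Fin.last n) = c i)
    (h21 : ∀ i, A (Fin.last n) (Fin.castSucc i) = c i)
    (h22 : A (Fin.last n) (Fin.last n) = g)
    (hB : ∀ i j, B i j = B j i)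
    (hc : ∀ i, ∑ j, B i j * b j = c i)
    (hg : g = ∑ j, c j * b j + s)
    (hdet : A.det ≠ 0) (i j : Fin n) :
    A.adjugate (Fin.castSucc i) (Fin.castSucc j) = b i * b j * B.det + s * B.adjugate i j := by
  have key : ∀ v : Fin (n+1) → ℝ, A.adjugate *ᵥ (A *ᵥ v) = A.det • v := by
    intro v
    rw [Matrix.mulVec_mulVec, Matrix.adjugate_mul, Matrix.smul_mulVec, Matrix.one_mulVec]
  have hBadj : ∀ r, ∑ k, B r k * B.adjugate k j = if r = j then B.det else 0 := by
    intro r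
    have := congrFun (congrFun (Matrix.mul_adjugate B) r) j
    rw [Matrix.mul_apply] at this
    rw [this]
    simp [Matrix.one_apply]
  have hw : A *ᵥ (Fin.snoc b (-1) : Fin (n+1) → ℝ) = Pi.single (Fin.last n) (-s) := by
    funext r
    refine Fin.lastCases ?_ (fun r => ?_) r
    · simp [Matrix.mulVec, dotProduct, Fin.sum_univ_castSucc, h21, h22, hg]
    · simp [Matrix.mulVec, dotProduct, Fin.sum_univ_castSucc, h11, h12, hc,
        (Fin.castSucc_lt_last r).ne]
  have hsub : A.submatrix Fin.castSucc Fin.castSucc = B := by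
    ext i j; simp [h11]
  have hlast : A.adjugate (Fin.last n) (Fin.last n) = B.det := by
    rw [Matrix.adjugate_fin_succ_eq_det_submatrix]
    simp [← two_mul, pow_mul, hsub]
  have hdA : A.det = s * B.det := by
    have h := congrFun (key (Fin.snoc b (-1))) (Fin.last n)
    rw [hw] at h
    simp [hlast] at h
    linarith
  have hv : A *ᵥ (Fin.snoc (fun k => b k * b j * B.det + s * B.adjugate k j) (-(B.det * b j)) :
      Fin (n+1) → ℝ) = Pi.single (Fin.castSucc j) A.det := by
    funext r
    refine Fin.lastCases ?_ (fun r => ?_) r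
    · have h1 : ∑ k, c k * B.adjugate k j = b j * B.det := by
        calc ∑ k, c k * B.adjugate k j = ∑ k, ∑ l, b l * (B l k * B.adjugate k j) := by
              refine Finset.sum_congr rfl fun k _ => ?_
              rw [← hc, Finset.sum_mul]
              refine Finset.sum_congr rfl fun l _ => ?_
              rw [hB k l]; ring
          _ = ∑ l, b l * ∑ k, (B l k * B.adjugate k j) := by
              rw [Finset.sum_comm]; simp [Finset.mul_sum]
          _ = _ := by simp [hBadj]
      have h2 : ∑ k, c k * (b k * b j * B.det + s * B.adjugate k j)
          = (∑ k, c k * b k) * (b j * B.det) + s * ∑ k, c k * B.adjugate k j := by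
        rw [Finset.sum_mul, Finset.mul_sum, ← Finset.sum_add_distrib]
        exact Finset.sum_congr rfl fun k _ => by ring
      simp only [Matrix.mulVec, dotProduct, Fin.sum_univ_castSucc, h21, h22, Fin.snoc_castSucc,
        Fin.snoc_last]
      rw [h2, h1, hg, Pi.single_eq_of_ne (Fin.castSucc_lt_last j).ne']
      ring
    · have h2 : ∑ k, B r k * (b k * b j * B.det + s * B.adjugate k j)
          = (∑ k, B r k * b k) * (b j * B.det) + s * ∑ k, B r k * B.adjugate k j := by
        rw [Finset.sum_mul, Finset.mul_sum, ← Finset.sum_add_distrib]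
        exact Finset.sum_congr rfl fun k _ => by ring
      simp only [Matrix.mulVec, dotProduct, Fin.sum_univ_castSucc, h11, h12, Fin.snoc_castSucc,
        Fin.snoc_last]
      rw [h2, hc, hBadj, Pi.single_apply, hdA]
      simp only [Fin.castSucc_inj]
      split_ifs <;> ring
  have h := congrFun (key (Fin.snoc (fun k => b k * b j * B.det + s * B.adjugate k j)
    (-(B.det * b j)))) (Fin.castSucc i)
  rw [hv] at h
  simp only [Matrix.mulVec_single, Pi.smul_apply, Fin.snoc_castSucc, smul_eq_mul] at h
  have h' : A.det * A.adjugate (Fin.castSucc i) (Fin.castSucc j) =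
      A.det * (b i * b j * B.det + s * B.adjugate i j) := by
    rw [← h]; simp [mul_comm]
  exact mul_left_cancel₀ hdet h'

/-- Reindexing of the lagged sum. -/
theorem lag_sum (p n : ℕ) (hn : p ≤ n) (φ : ℕ → ℝ) (f : ℤ → ℝ) :
    ∑ l : Fin n, f (l : ℕ) * (if n - (l : ℕ) ≤ p then φ (n - l) else 0)
      = ∑ i ∈ Finset.Icc 1 p, φ i * f ((n : ℤ) - i) := by
  rw [Fin.sum_univ_eq_sum_range
    (fun l : ℕ => f (l : ℕ) * (if n - (l : ℕ) ≤ p then φ (n - l) else 0)) n]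
  simp only [mul_ite, mul_zero]
  rw [← Finset.sum_filter]
  refine Finset.sum_bij' (fun l _ => n - l) (fun i _ => n - i) ?_ ?_ ?_ ?_ ?_
  · intro l hl; simp at hl ⊢; omega
  · intro l hl; simp at hl ⊢; omega
  · intro l hl; simp at hl ⊢; omega
  · intro l hl; simp at hl ⊢; omega
  · intro l hl
    simp at hl
    rw [Nat.cast_sub hl.1.le, mul_comm]
    congr 2
    ring

/-- Context: AR(p) coefficients `φ`, white-noise variance `σ2`, autocovariance
sequence `γ` satisfying the Yule–Walker equations, and the autocovariance
Toeplitz matrices `Γ m`, assumed positive definite for `m ≥ 1`. -/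
theorem stmt_17
    (p : ℕ) (hp : 1 ≤ p)
    (φ : ℕ → ℝ)
    (σ2 : ℝ) (hσ : 0 < σ2)
    (γ : ℤ → ℝ)
    (hsym : ∀ j : ℤ, γ (-j) = γ j)
    (hYW0 : γ 0 = (∑ i ∈ Finset.Icc 1 p, φ i * γ (i : ℤ)) + σ2)
    (hYW : ∀ j : ℤ, 1 ≤ j → γ j = ∑ i ∈ Finset.Icc 1 p, φ i * γ (j - (i : ℤ)))
    (Γ : (m : ℕ) → Matrix (Fin m) (Fin m) ℝ)
    (hΓ : ∀ m : ℕ, ∀ i j : Fin m, Γ m i j = γ |(i : ℤ) - (j : ℤ)|)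
    (hpd : ∀ m : ℕ, 1 ≤ m → (Γ m).PosDef)
    (m : ℕ) (hm1 : p + 2 ≤ m) (hm2 : m ≤ 2 * p + 1)
    (i : ℕ) (hi1 : 1 ≤ i) (hi2 : i ≤ m - p - 1) :
    (Γ m).adjugate ⟨p + i - 1, by omega⟩ ⟨p, by omega⟩
      = φ (m - p - 1) * φ (m - p - i) * (Γ (m - 1)).det
        + σ2 * (Γ (m - 1)).adjugate ⟨p + i - 1, by omega⟩ ⟨p, by omega⟩ := by
  obtain ⟨n, rfl⟩ : ∃ n, m = n + 1 := ⟨m - 1, by omega⟩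
  have habs : ∀ j : ℤ, γ |j| = γ j := by
    intro j
    rcases abs_choice j with h | h <;> rw [h]
    exact hsym j
  have H := bordered_adj n (Γ (n+1)) (Γ n)
    (fun l => if n - (l : ℕ) ≤ p then φ (n - l) else 0) (fun k => γ ((n : ℤ) - (k : ℕ))) (γ 0) σ2
    (by intro i j; rw [hΓ, hΓ]; rfl)
    (by intro i; rw [hΓ, habs, ← hsym]; congr 1; simp)
    (by intro i; rw [hΓ, habs]; congr 1)
    (by rw [hΓ]; simp)
    (by intro i j; rw [hΓ, hΓ, abs_sub_comm])
    (by
      intro k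
      simp only [hΓ, habs]
      rw [lag_sum p n (by omega) φ (fun l => γ ((k : ℕ) - l)), hYW _ (by omega)]
      refine Finset.sum_congr rfl fun i _ => ?_
      rw [← hsym]
      congr 2
      ring)
    (by
      rw [lag_sum p n (by omega) φ (fun l => γ (n - l)), hYW0]
      simp)
    (hpd (n+1) (by omega)).det_pos.ne' ⟨p + i - 1, by omega⟩ ⟨p, by omega⟩
  have e1 : n - (p + i - 1) = n + 1 - p - i := by omega
  have e2 : n - p = n + 1 - p - 1 := by omega
  simp only [e1] at H
  rw [if_pos (by omega), if_pos (by omega), e2] at H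
  rw [mul_comm (φ (n + 1 - p - 1))]
  exact H
end
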